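/- arXiv:2508.19362 — 2 statements merged into one kernel-verified Lean document; each statement's English description precedes it below -/
import Mathlib

section
/- Let Tⁿ be the flat n-torus, p ∈ Tⁿ, q = p + (1/2, …, 1/2) the antipodal point, and 0 < ε < 1/2. Fix 0 ≤ i ≤ n and let B = ∏_{k=1}^{i} [q_k, q_k + ε] × ∏_{k=i+1}^{n} {q_k} ⊆ Tⁿ (an axis-oriented i-dimensional ε-box with q as a vertex). Then the set E = {p} × B ⊆ Tⁿ × Tⁿ admits exactly 2^{n−i} GMPRs, distinguished by the choice, for each dimension k ∈ {i+1, …, n}, of the direction (up or down from p in coordinate k) taken by the chosen geodesics. -/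
/-- A geodesic in a metric space: a continuous path `γ : [0,1] → X` moving at
constant speed `c` and realizing distances, i.e. `d(γ s, γ t) = c·|s − t|`. -/
def IsGeodesic {X : Type*} [PseudoMetricSpace X] (γ : C(unitInterval, X)) : Prop :=
  ∃ c : ℝ, ∀ s t : unitInterval, dist (γ s) (γ t) = c * |(s : ℝ) - (t : ℝ)|

/-- A geodesic motion planning rule (GMPR) on `E ⊆ X × X`: a map, continuous
on `E`, sending each pair `(x, y) ∈ E` to a geodesic from `x` to `y`. -/
def IsGMPROn {X : Type*} [PseudoMetricSpace X] (E : Set (X × X))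
    (σ' : X × X → C(unitInterval, X)) : Prop :=
  ContinuousOn σ' E ∧ ∀ e ∈ E, IsGeodesic (σ' e) ∧ σ' e 0 = e.1 ∧ σ' e 1 = e.2

/-- The integer lattice `ℤⁿ` inside Euclidean space `ℝⁿ`. -/
noncomputable def intLattice (n : ℕ) : AddSubgroup (EuclideanSpace ℝ (Fin n)) where
  carrier := {x | ∀ i, ∃ m : ℤ, x i = m}
  zero_mem' := fun i => ⟨0, by simp⟩
  add_mem' := by
    intro a b ha hb i
    obtain ⟨m, hm⟩ := ha i
    obtain ⟨l, hl⟩ := hb i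
    exact ⟨m + l, by push_cast [PiLp.add_apply, hm, hl]; ring⟩
  neg_mem' := by
    intro a ha i
    obtain ⟨m, hm⟩ := ha i
    exact ⟨-m, by push_cast [PiLp.neg_apply, hm]; ring⟩

instance intLattice_isClosed (n : ℕ) :
    IsClosed ((intLattice n : AddSubgroup (EuclideanSpace ℝ (Fin n))) :
      Set (EuclideanSpace ℝ (Fin n))) := by
  have : ((intLattice n : AddSubgroup (EuclideanSpace ℝ (Fin n))) :
      Set (EuclideanSpace ℝ (Fin n))) =
      ⋂ i, (fun x : EuclideanSpace ℝ (Fin n) => x i) ⁻¹'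
        (Set.range ((↑) : ℤ → ℝ)) := by
    ext x
    simp [intLattice, Set.mem_iInter, eq_comm]
  rw [this]
  exact isClosed_iInter fun i =>
    Int.isClosedEmbedding_coe_real.isClosed_range.preimage
      (EuclideanSpace.proj i).continuous

/-- The flat `n`-torus `ℝⁿ/ℤⁿ`, equipped with the quotient metric induced by
the Euclidean metric on `ℝⁿ`. -/
abbrev FlatTorus (n : ℕ) := EuclideanSpace ℝ (Fin n) ⧸ intLattice n


/-- The vector `(1/2, …, 1/2)` of `ℝⁿ`. -/
noncomputable def halfVec (n : ℕ) : EuclideanSpace ℝ (Fin n) :=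
  (WithLp.equiv 2 (Fin n → ℝ)).symm fun _ => (1 : ℝ) / 2


theorem ft_mk_eq_iff {n : ℕ} (x y : EuclideanSpace ℝ (Fin n)) :
    (QuotientAddGroup.mk x : FlatTorus n) = QuotientAddGroup.mk y ↔
      ∀ k, ∃ m : ℤ, y k - x k = m := by
  rw [QuotientAddGroup.eq]
  change (∀ k, ∃ m : ℤ, (-x + y) k = m) ↔ _
  refine forall_congr' fun k => exists_congr fun m => ?_
  rw [PiLp.add_apply, PiLp.neg_apply, neg_add_eq_sub]

theorem ft_mk_inj {n : ℕ} (x y : EuclideanSpace ℝ (Fin n))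
    (h : (QuotientAddGroup.mk x : FlatTorus n) = QuotientAddGroup.mk y)
    (h1 : ∀ k, |y k - x k| < 1) : x = y := by
  rw [ft_mk_eq_iff] at h
  ext k
  obtain ⟨m, hm⟩ := h k
  have := h1 k
  rw [hm] at this
  have h2 : |m| < 1 := by
    have h2 : ((|m| : ℤ) : ℝ) < ((1 : ℤ) : ℝ) := by rw [Int.cast_abs, Int.cast_one]; exact this
    exact Int.cast_lt.1 h2
  have h3 : m = 0 := Int.abs_lt_one_iff.mp h2
  rw [h3] at hm
  push_cast at hm
  linarith

theorem ft_abs_le {a b : ℝ} (h : |a| ≤ 1 / 2) (hb : ∃ m : ℤ, b - a = m) : |a| ≤ |b| := by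
  obtain ⟨m, hm⟩ := hb
  rcases eq_or_ne m 0 with h0 | h0
  · rw [h0] at hm; push_cast at hm
    rw [show b = a by linarith]
  · have h1 : (1 : ℝ) ≤ |(m : ℝ)| := by exact_mod_cast Int.one_le_abs h0
    have h2 : |(m : ℝ)| ≤ |b| + |a| := by rw [← hm]; exact abs_sub b a
    linarith

theorem ft_norm_mk {n : ℕ} (x : EuclideanSpace ℝ (Fin n)) (h : ∀ k, |x k| ≤ 1 / 2) :
    ‖(QuotientAddGroup.mk x : FlatTorus n)‖ = ‖x‖ := by
  apply le_antisymm
  · exact QuotientAddGroup.norm_mk_le_norm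
  · rw [QuotientAddGroup.le_norm_iff]
    intro y hy
    rw [EuclideanSpace.norm_eq, EuclideanSpace.norm_eq]
    apply Real.sqrt_le_sqrt
    apply Finset.sum_le_sum
    intro k _
    have := ft_abs_le (h k) ((ft_mk_eq_iff x y).1 hy.symm k)
    simp only [Real.norm_eq_abs]
    gcongr

theorem ft_exists_lift {n : ℕ} (a : FlatTorus n) :
    ∃ x : EuclideanSpace ℝ (Fin n), QuotientAddGroup.mk x = a ∧ ∀ k, |x k| ≤ 1 / 2 := by
  obtain ⟨y, rfl⟩ := QuotientAddGroup.mk_surjective a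
  refine ⟨WithLp.toLp 2 fun k => y k - round (y k), ?_, fun k => abs_sub_round (y k)⟩
  rw [ft_mk_eq_iff]
  intro k
  exact ⟨round (y k), by simp⟩

theorem ft_min_lift {n : ℕ} (x : EuclideanSpace ℝ (Fin n))
    (h : ‖(QuotientAddGroup.mk x : FlatTorus n)‖ = ‖x‖) : ∀ k, |x k| ≤ 1 / 2 := by
  obtain ⟨y, hy, hy2⟩ := ft_exists_lift (QuotientAddGroup.mk x : FlatTorus n)
  have h1 := ft_norm_mk y hy2
  rw [hy, h, EuclideanSpace.norm_eq, EuclideanSpace.norm_eq,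
    Real.sqrt_inj (by positivity) (by positivity)] at h1
  have hle : ∀ k, |y k| ≤ |x k| := fun k => ft_abs_le (hy2 k) ((ft_mk_eq_iff y x).1 hy k)
  have h2 := (Finset.sum_eq_sum_iff_of_le (s := Finset.univ)
    (f := fun k => ‖y k‖ ^ 2) (g := fun k => ‖x k‖ ^ 2) (fun k _ => by
      simp only [Real.norm_eq_abs]; have := hle k; gcongr)).1 h1.symm
  intro k
  have h3 := h2 k (Finset.mem_univ k)
  simp only [Real.norm_eq_abs] at h3
  have h4 : |y k| = |x k| := by
    rwa [sq_eq_sq₀ (abs_nonneg _) (abs_nonneg _)] at h3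
  rw [← h4]; exact hy2 k

theorem ft_three {n : ℕ} (a b : FlatTorus n) (s c : ℝ)
    (ha : ‖a‖ = s * c) (hb : ‖b‖ = (1 - s) * c) (hab : ‖a + b‖ = c) :
    ∃ v : EuclideanSpace ℝ (Fin n), (∀ k, |v k| ≤ 1 / 2) ∧
      QuotientAddGroup.mk v = a + b ∧ QuotientAddGroup.mk (s • v) = a := by
  obtain ⟨x, rfl, hx⟩ := ft_exists_lift a
  obtain ⟨y, rfl, hy⟩ := ft_exists_lift b
  rw [ft_norm_mk x hx] at ha
  rw [ft_norm_mk y hy] at hb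
  have e : (QuotientAddGroup.mk x + QuotientAddGroup.mk y : FlatTorus n) =
    QuotientAddGroup.mk (x + y) := rfl
  rw [e] at hab ⊢
  have h1 : ‖(QuotientAddGroup.mk (x + y) : FlatTorus n)‖ ≤ ‖x + y‖ :=
    QuotientAddGroup.norm_mk_le_norm
  have h2 := norm_add_le x y
  have h3 : ‖x + y‖ = ‖x‖ + ‖y‖ := by linarith
  refine ⟨x + y, ft_min_lift _ (by linarith), rfl, ?_⟩
  have h4 := sameRay_iff_norm_smul_eq.1 (sameRay_iff_norm_add.2 h3)
  congr 1
  rcases eq_or_ne c 0 with hc | hc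
  · have hx0 : x = 0 := by rw [← norm_eq_zero, ha, hc, mul_zero]
    have hy0 : y = 0 := by rw [← norm_eq_zero, hb, hc, mul_zero]
    simp [hx0, hy0]
  · rw [ha, hb] at h4
    ext k
    have h5 := congrArg (fun z : EuclideanSpace ℝ (Fin n) => z k) h4
    simp only [PiLp.smul_apply, smul_eq_mul, PiLp.add_apply] at h5 ⊢
    have h6 : c * (s * y k) = c * ((1 - s) * x k) := by linarith
    have h7 := mul_left_cancel₀ hc h6
    linarith

theorem ft_geod_aux {n : ℕ} (γ : C(unitInterval, FlatTorus n)) (h : IsGeodesic γ)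
    (s t : unitInterval) (hst : s ≤ t) (ht : 0 < (t : ℝ)) :
    ∃ v : EuclideanSpace ℝ (Fin n), (∀ k, |v k| ≤ 1 / 2) ∧
      QuotientAddGroup.mk v = γ t - γ 0 ∧
      QuotientAddGroup.mk (((s : ℝ) / t) • v) = γ s - γ 0 := by
  obtain ⟨c, hc⟩ := h
  have hs0 := s.2.1
  have hst' : (s : ℝ) ≤ t := hst
  have := ft_three (γ s - γ 0) (γ t - γ s) ((s : ℝ) / t) (c * t)
    (by rw [← dist_eq_norm, hc]; simp [abs_of_nonneg hs0]; field_simp)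
    (by rw [← dist_eq_norm, hc, abs_of_nonneg (by linarith)]; field_simp)
    (by rw [add_comm, sub_add_sub_cancel, ← dist_eq_norm, hc]; simp [abs_of_pos ht])
  have e : γ s - γ 0 + (γ t - γ s) = γ t - γ 0 := by abel
  rwa [e] at this

theorem ft_geod {n : ℕ} (γ : C(unitInterval, FlatTorus n)) (h : IsGeodesic γ)
    (pl : EuclideanSpace ℝ (Fin n)) (hp : γ 0 = QuotientAddGroup.mk pl) :
    ∃ v : EuclideanSpace ℝ (Fin n), (∀ k, |v k| ≤ 1 / 2) ∧
      ∀ t : unitInterval, γ t = QuotientAddGroup.mk (pl + (t : ℝ) • v) := by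
  have h1 : ∀ t : unitInterval, ∃ w : EuclideanSpace ℝ (Fin n), (∀ k, |w k| ≤ 1 / 2) ∧
      QuotientAddGroup.mk w = γ 1 - γ 0 ∧
      QuotientAddGroup.mk ((t : ℝ) • w) = γ t - γ 0 := by
    intro t
    simpa using ft_geod_aux γ h t 1 t.2.2 (by simp)
  choose w hw hw1 hwt using h1
  have small : ∀ (t : unitInterval) (u : EuclideanSpace ℝ (Fin n)), (∀ k, |u k| ≤ 1 / 2) →
      (t : ℝ) < 1 → ∀ k, |((t : ℝ) • u) k| < 1 / 2 := by
    intro t u hu ht k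
    rw [PiLp.smul_apply, smul_eq_mul, abs_mul, abs_of_nonneg t.2.1]
    have := hu k
    have := abs_nonneg (u k)
    have := t.2.1
    nlinarith
  have key : ∀ s t : unitInterval, 0 < (s : ℝ) → s ≤ t → (t : ℝ) < 1 → w s = w t := by
    intro s t hs hst ht
    have hst' : (s : ℝ) ≤ t := hst
    have ht0 : 0 < (t : ℝ) := by linarith
    obtain ⟨u, hu, hu1, hu2⟩ := ft_geod_aux γ h s t hst ht0
    have e1 : (t : ℝ) • w t = u := by
      apply ft_mk_inj
      · rw [hwt, hu1]
      · intro k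
        have h1 := small t (w t) (hw t) ht k
        have h2 := hu k
        have h3 := abs_sub (u k) (((t : ℝ) • w t) k)
        linarith
    have e2 : (s : ℝ) • w s = (s : ℝ) • w t := by
      apply ft_mk_inj
      · rw [hwt, ← hu2, ← e1, smul_smul, div_mul_cancel₀ _ ht0.ne']
      · intro k
        have h1 := small s (w s) (hw s) (by linarith) k
        have h2 := small s (w t) (hw t) (by linarith) k
        have h3 := abs_sub (((s : ℝ) • w t) k) (((s : ℝ) • w s) k)
        linarith
    exact smul_right_injective _ hs.ne' e2
  let r : unitInterval := ⟨1 / 2, by norm_num, by norm_num⟩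
  have hr : (r : ℝ) = 1 / 2 := rfl
  refine ⟨w r, hw r, fun t => ?_⟩
  have e : (QuotientAddGroup.mk (pl + (t : ℝ) • w r) : FlatTorus n) =
    QuotientAddGroup.mk pl + QuotientAddGroup.mk ((t : ℝ) • w r) := rfl
  rw [e, ← hp]
  suffices hh : (QuotientAddGroup.mk ((t : ℝ) • w r) : FlatTorus n) = γ t - γ 0 by
    rw [hh]; abel
  rcases eq_or_lt_of_le t.2.1 with h0 | h0
  · have : t = 0 := Subtype.ext h0.symm
    subst this
    simp
  · rcases eq_or_lt_of_le t.2.2 with h2 | h2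
    · have : t = 1 := Subtype.ext h2
      subst this
      simp [hw1]
    · have : w r = w t := by
        rcases le_total r t with hh | hh
        · exact key r t (by rw [hr]; norm_num) hh h2
        · exact (key t r h0 hh (by rw [hr]; norm_num)).symm
      rw [this, hwt]

/-- The straight path `t ↦ [pl + t v]` in the flat torus. -/
noncomputable def ftPath {n : ℕ} (pl v : EuclideanSpace ℝ (Fin n)) :
    C(unitInterval, FlatTorus n) :=
  ⟨fun t => QuotientAddGroup.mk (pl + (t : ℝ) • v), by
    apply QuotientAddGroup.continuous_mk.comp
    fun_prop⟩

theorem ftPath_apply {n : ℕ} (pl v : EuclideanSpace ℝ (Fin n)) (t : unitInterval) :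
    ftPath pl v t = QuotientAddGroup.mk (pl + (t : ℝ) • v) := rfl

theorem ftPath_geod {n : ℕ} (pl v : EuclideanSpace ℝ (Fin n)) (hv : ∀ k, |v k| ≤ 1 / 2) :
    IsGeodesic (ftPath pl v) := by
  refine ⟨‖v‖, fun s t => ?_⟩
  rw [dist_eq_norm, ftPath_apply, ftPath_apply]
  have e : (QuotientAddGroup.mk (pl + (s : ℝ) • v) - QuotientAddGroup.mk (pl + (t : ℝ) • v) :
      FlatTorus n) = QuotientAddGroup.mk (((s : ℝ) - t) • v) := by
    rw [← QuotientAddGroup.mk_sub]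
    congr 1
    module
  rw [e, ft_norm_mk, norm_smul, Real.norm_eq_abs, mul_comm]
  intro k
  rw [PiLp.smul_apply, smul_eq_mul, abs_mul]
  have h1 : |(s : ℝ) - t| ≤ 1 := by
    rw [abs_le]
    constructor <;> linarith [s.2.1, s.2.2, t.2.1, t.2.2]
  calc _ ≤ 1 * |v k| := by gcongr
    _ ≤ _ := by rw [one_mul]; exact hv k

theorem ftPath_continuous {n : ℕ} (pl : EuclideanSpace ℝ (Fin n)) :
    Continuous (fun v => ftPath pl v) := by
  apply ContinuousMap.continuous_of_continuous_uncurry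
  apply QuotientAddGroup.continuous_mk.comp
  fun_prop

/-- The midpoint of the unit interval. -/
noncomputable def ftHalf : unitInterval := ⟨1 / 2, by norm_num, by norm_num⟩

theorem ftPath_inj {n : ℕ} (pl v w : EuclideanSpace ℝ (Fin n)) (hv : ∀ k, |v k| ≤ 1 / 2)
    (hw : ∀ k, |w k| ≤ 1 / 2) (h : ftPath pl v = ftPath pl w) : v = w := by
  have h1 := DFunLike.congr_fun h ftHalf
  rw [ftPath_apply, ftPath_apply] at h1
  have h2 := ft_mk_inj _ _ h1 (by
    intro k
    simp only [PiLp.add_apply, PiLp.smul_apply, smul_eq_mul, ftHalf]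
    have := abs_le.1 (hv k)
    have := abs_le.1 (hw k)
    rw [abs_lt]
    constructor <;> linarith)
  have h3 := add_left_cancel h2
  exact smul_right_injective _ (by norm_num [ftHalf]) h3

theorem ft_emb {n : ℕ} (C : Set (EuclideanSpace ℝ (Fin n))) (hC : IsCompact C)
    (h : ∀ x ∈ C, ∀ y ∈ C, ∀ k, |y k - x k| < 1) :
    Topology.IsEmbedding (fun x : C => (QuotientAddGroup.mk (x : EuclideanSpace ℝ (Fin n)) :
      FlatTorus n)) := by
  have : CompactSpace C := isCompact_iff_compactSpace.1 hC
  have hc : Continuous (fun x : C => (QuotientAddGroup.mk (x : EuclideanSpace ℝ (Fin n)) :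
      FlatTorus n)) := QuotientAddGroup.continuous_mk.comp continuous_subtype_val
  refine (hc.isClosedEmbedding ?_).isEmbedding
  intro x y hxy
  exact Subtype.ext (ft_mk_inj _ _ hxy (h x x.2 y y.2))

theorem ft_box_compact {n : ℕ} (a b : Fin n → ℝ) :
    IsCompact {x : EuclideanSpace ℝ (Fin n) | ∀ k, x k ∈ Set.Icc (a k) (b k)} := by
  have h := (isCompact_univ_pi (fun k => isCompact_Icc (a := a k) (b := b k))).image
    (PiLp.continuous_toLp 2 (fun _ : Fin n => ℝ))
  convert h using 1
  ext x
  constructor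
  · intro hx
    exact ⟨fun k => x k, fun k _ => hx k, rfl⟩
  · rintro ⟨y, hy, rfl⟩ k
    exact hy k trivial

theorem ft_box_convex {n : ℕ} (a b : Fin n → ℝ) :
    Convex ℝ {x : EuclideanSpace ℝ (Fin n) | ∀ k, x k ∈ Set.Icc (a k) (b k)} := by
  intro x hx y hy s t hs ht hst k
  exact convex_Icc (a k) (b k) (hx k) (hy k) hs ht hst

theorem ft_lift_cont {n : ℕ} {X : Type*} [TopologicalSpace X] (pl : EuclideanSpace ℝ (Fin n))
    (f : X → EuclideanSpace ℝ (Fin n)) (hf : ∀ x k, |f x k| ≤ 1 / 2)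
    (hc : Continuous (fun x => ftPath pl (f x))) : Continuous f := by
  have hemb := ft_emb _ (ft_box_compact (n := n) (fun _ => -(1 / 4)) (fun _ => 1 / 4)) (by
    intro x hx y hy k
    have h1 := hx k
    have h2 := hy k
    rw [Set.mem_Icc] at h1 h2
    rw [abs_lt]
    constructor <;> linarith)
  let F : X → {x : EuclideanSpace ℝ (Fin n) | ∀ k, x k ∈ Set.Icc (-(1 / 4) : ℝ) (1 / 4)} :=
    fun x => ⟨(1 / 2 : ℝ) • f x, fun k => by
      have := abs_le.1 (hf x k)
      rw [PiLp.smul_apply, smul_eq_mul, Set.mem_Icc]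
      constructor <;> linarith⟩
  have hF : Continuous F := by
    rw [hemb.continuous_iff]
    have h1 : Continuous (fun x => ftPath pl (f x) ftHalf - QuotientAddGroup.mk pl) :=
      ((continuous_eval_const (F := C(unitInterval, FlatTorus n)) ftHalf).comp hc).sub continuous_const
    convert h1 using 2 with x
    rw [ftPath_apply, ← QuotientAddGroup.mk_sub]
    simp [F, ftHalf]
  have h2 : Continuous (fun x => (2 : ℝ) • (F x : EuclideanSpace ℝ (Fin n))) :=
    Continuous.const_smul (g := fun x => (F x : EuclideanSpace ℝ (Fin n)))
      (continuous_subtype_val.comp hF) (2 : ℝ)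
  convert h2 using 2 with x
  simp [F]

/-- The integer shift vector attached to a choice of directions. -/
noncomputable def ftShift {n i : ℕ} (S : {k : Fin n // i ≤ (k : ℕ)} → Bool) :
    EuclideanSpace ℝ (Fin n) :=
  WithLp.toLp 2 fun k => if h : i ≤ (k : ℕ) then (if S ⟨k, h⟩ then 0 else -1) else -1

theorem ftShift_int {n i : ℕ} (S : {k : Fin n // i ≤ (k : ℕ)} → Bool) (k : Fin n) :
    ∃ m : ℤ, ftShift S k = m := by
  simp only [ftShift]
  split_ifs
  · exact ⟨0, by simp⟩
  · exact ⟨-1, by simp⟩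
  · exact ⟨-1, by simp⟩

theorem ft_card (n i : ℕ) : Nat.card ({k : Fin n // i ≤ (k : ℕ)} → Bool) = 2 ^ (n - i) := by
  rw [Nat.card_fun, Nat.card_eq_fintype_card, Nat.card_eq_fintype_card, Fintype.card_bool]
  congr 1
  have h : Fintype.card {k : Fin n // i ≤ (k : ℕ)} = Fintype.card (Fin (n - i)) := by
    refine Fintype.card_congr ⟨fun k => ⟨k.1 - i, by have := k.1.2; have := k.2; omega⟩,
      fun j => ⟨⟨j + i, by have := j.2; omega⟩, by simp⟩, fun k => ?_, fun j => ?_⟩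
    · have := k.2
      ext
      simp
      omega
    · ext
      simp
  rw [h, Fintype.card_fin]

theorem ftShift_inj {n i : ℕ} (S S' : {k : Fin n // i ≤ (k : ℕ)} → Bool)
    (h : ftShift S = ftShift S') : S = S' := by
  funext k
  have h3 : ftShift S k.1 = ftShift S' k.1 := by rw [h]
  simp only [ftShift, k.2, dif_pos] at h3
  cases h4 : S k <;> cases h5 : S' k
  · rfl
  · simp [h4, h5] at h3
  · simp [h4, h5] at h3
  · rfl

set_option maxHeartbeats 1000000 in
/-- **Counting GMPRs over an axis-oriented box at the antipode.**
Let `p ∈ Tⁿ` (with lift `pl`), `q = p + (1/2, …, 1/2)` (with lift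
`ql = pl + (1/2, …, 1/2)`), `0 < ε < 1/2` and `0 ≤ i ≤ n`.  Let
`B = ∏_{k<i} [q_k, q_k + ε] × ∏_{k≥i} {q_k}` be the `i`-dimensional
axis-oriented `ε`-box with vertex `q` (given by the image in `Tⁿ` of the
corresponding box of lifts).  Then the set `E = {p} × B ⊆ Tⁿ × Tⁿ` admits
exactly `2^(n−i)` geodesic motion planning rules (as maps defined on `E`;
they are distinguished by the direction, up or down from `p`, chosen in each
of the remaining `n − i` coordinates). -/
theorem flatTorus_card_gmpr_on_box (n i : ℕ) (hi : i ≤ n)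
    (pl : EuclideanSpace ℝ (Fin n)) (ε : ℝ) (hε : 0 < ε) (hε' : ε < 1 / 2)
    (ql : EuclideanSpace ℝ (Fin n)) (hql : ql = pl + halfVec n)
    (B : Set (FlatTorus n))
    (hB : B = QuotientAddGroup.mk ''
      {x : EuclideanSpace ℝ (Fin n) | ∀ k : Fin n,
        ((k : ℕ) < i → x k ∈ Set.Icc (ql k) (ql k + ε)) ∧
        (i ≤ (k : ℕ) → x k = ql k)}) :
    {g : ({(QuotientAddGroup.mk pl : FlatTorus n)} ×ˢ B :
        Set (FlatTorus n × FlatTorus n)) → C(unitInterval, FlatTorus n) |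
      ∃ σ' : FlatTorus n × FlatTorus n → C(unitInterval, FlatTorus n),
        IsGMPROn ({(QuotientAddGroup.mk pl : FlatTorus n)} ×ˢ B) σ' ∧
        g = Set.restrict _ σ'}.ncard = 2 ^ (n - i) := by
  classical
  -- rewrite the box in standard form
  set K : Set (EuclideanSpace ℝ (Fin n)) := {x | ∀ k : Fin n,
        ((k : ℕ) < i → x k ∈ Set.Icc (ql k) (ql k + ε)) ∧
        (i ≤ (k : ℕ) → x k = ql k)} with hK
  have hKbox : K = {x : EuclideanSpace ℝ (Fin n) |
      ∀ k, x k ∈ Set.Icc (ql k) (if (k : ℕ) < i then ql k + ε else ql k)} := by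
    ext x
    refine forall_congr' fun k => ?_
    by_cases h : (k : ℕ) < i
    · simp [h]
    · have h' : i ≤ (k : ℕ) := not_lt.1 h
      simp only [h, h', if_false, false_imp_iff, true_and, true_imp_iff, Set.Icc_self,
        Set.mem_singleton_iff]
  have hqk : ∀ k, ql k = pl k + 1 / 2 := by
    intro k
    rw [hql]
    simp [halfVec]
  have hKc : IsCompact K := by rw [hKbox]; exact ft_box_compact _ _
  have hKconv : Convex ℝ K := by rw [hKbox]; exact ft_box_convex _ _
  have hKle : ∀ x ∈ K, ∀ k, ql k ≤ x k ∧ x k ≤ ql k + ε := by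
    intro x hx k
    rcases lt_or_ge (k : ℕ) i with h | h
    · exact (hx k).1 h
    · have := (hx k).2 h
      constructor <;> linarith
  have hKdiff : ∀ x ∈ K, ∀ y ∈ K, ∀ k, |y k - x k| < 1 := by
    intro x hx y hy k
    have h1 := hKle x hx k
    have h2 := hKle y hy k
    rw [abs_lt]
    constructor <;> linarith
  have hemb := ft_emb K hKc hKdiff
  have hqK : ql ∈ K := fun k => ⟨fun _ => ⟨le_refl _, by linarith⟩, fun _ => rfl⟩
  -- the section of the projection over the box
  obtain ⟨s, hs⟩ : ∃ s : FlatTorus n → EuclideanSpace ℝ (Fin n),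
      ∀ x ∈ K, s (QuotientAddGroup.mk x) = x := by
    refine ⟨Function.invFunOn (fun x => (QuotientAddGroup.mk x : FlatTorus n)) K,
      fun x hx => ?_⟩
    have hex : ∃ a ∈ K, (QuotientAddGroup.mk a : FlatTorus n) = QuotientAddGroup.mk x :=
      ⟨x, hx, rfl⟩
    have h1 := Function.invFunOn_mem hex
    have h2 := Function.invFunOn_eq hex
    exact ft_mk_inj _ _ h2 (hKdiff _ h1 x hx)
  have hsB : ∀ b ∈ B, s b ∈ K ∧ QuotientAddGroup.mk (s b) = b := by
    rw [hB]
    rintro _ ⟨x, hx, rfl⟩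
    rw [hs x hx]
    exact ⟨hx, rfl⟩
  have hscont : ContinuousOn s B := by
    rw [continuousOn_iff_continuous_restrict]
    let F : B → K := fun b => ⟨s b, (hsB b b.2).1⟩
    have hF : Continuous F := by
      rw [hemb.continuous_iff]
      convert continuous_subtype_val (p := fun b => b ∈ B) using 1
      ext b
      exact (hsB b b.2).2
    exact continuous_subtype_val.comp hF
  -- bounds for the shifted vectors
  have hbound : ∀ (S : {k : Fin n // i ≤ (k : ℕ)} → Bool), ∀ x ∈ K, ∀ k,
      |(x - pl + ftShift S) k| ≤ 1 / 2 := by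
    intro S x hx k
    have h1 := hKle x hx k
    have h2 := hqk k
    have h3 := (hx k).2
    simp only [PiLp.add_apply, PiLp.sub_apply, ftShift]
    rw [abs_le]
    split_ifs with h h'
    · have := h3 h
      constructor <;> linarith
    · constructor <;> linarith
    · constructor <;> linarith
  let σ : ({k : Fin n // i ≤ (k : ℕ)} → Bool) → FlatTorus n × FlatTorus n →
      C(unitInterval, FlatTorus n) := fun S e => ftPath pl (s e.2 - pl + ftShift S)
  have hσ : ∀ S, IsGMPROn ({(QuotientAddGroup.mk pl : FlatTorus n)} ×ˢ B) (σ S) := by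
    intro S
    refine ⟨?_, ?_⟩
    · apply (ftPath_continuous pl).comp_continuousOn
      apply ContinuousOn.add _ continuousOn_const
      apply ContinuousOn.sub _ continuousOn_const
      exact hscont.comp continuousOn_snd (fun e he => he.2)
    · rintro ⟨a, b⟩ ⟨ha, hb⟩
      obtain ⟨h1, h2⟩ := hsB b hb
      refine ⟨ftPath_geod _ _ (hbound S _ h1), ?_, ?_⟩
      · simp only [σ, ftPath_apply]
        have ha' : a = QuotientAddGroup.mk pl := ha
        rw [ha']
        simp
      · simp only [σ, ftPath_apply]
        rw [← h2, hs _ h1, ft_mk_eq_iff]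
        intro k
        obtain ⟨m, hm⟩ := ftShift_int S k
        refine ⟨-m, ?_⟩
        simp [hm]
        ring
  have hset : {g : ({(QuotientAddGroup.mk pl : FlatTorus n)} ×ˢ B :
        Set (FlatTorus n × FlatTorus n)) → C(unitInterval, FlatTorus n) |
      ∃ σ' : FlatTorus n × FlatTorus n → C(unitInterval, FlatTorus n),
        IsGMPROn ({(QuotientAddGroup.mk pl : FlatTorus n)} ×ˢ B) σ' ∧
        g = Set.restrict _ σ'} = Set.range (fun S => Set.restrict
          ({(QuotientAddGroup.mk pl : FlatTorus n)} ×ˢ B) (σ S)) := by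
    apply Set.Subset.antisymm
    · rintro g ⟨σ', ⟨hc, hg⟩, rfl⟩
      have hmem : ∀ x : K, ((QuotientAddGroup.mk pl, QuotientAddGroup.mk (x : EuclideanSpace ℝ (Fin n))) :
          FlatTorus n × FlatTorus n) ∈ ({(QuotientAddGroup.mk pl : FlatTorus n)} ×ˢ B :
          Set (FlatTorus n × FlatTorus n)) := by
        intro x
        refine ⟨rfl, ?_⟩
        rw [hB]
        exact ⟨x, x.2, rfl⟩
      have hv : ∀ x : K, ∃ v : EuclideanSpace ℝ (Fin n), (∀ k, |v k| ≤ 1 / 2) ∧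
          σ' (QuotientAddGroup.mk pl, QuotientAddGroup.mk (x : EuclideanSpace ℝ (Fin n))) =
            ftPath pl v := by
        intro x
        obtain ⟨h1, h2, h3⟩ := hg _ (hmem x)
        obtain ⟨v, hv, hv'⟩ := ft_geod _ h1 pl h2
        exact ⟨v, hv, ContinuousMap.ext hv'⟩
      choose v hv hv' using hv
      have hvc : Continuous v := by
        apply ft_lift_cont pl v hv
        simp only [← hv']
        refine hc.comp_continuous ?_ hmem
        exact continuous_const.prodMk
          (QuotientAddGroup.continuous_mk.comp continuous_subtype_val)
      have hN : ∀ (x : K) (k : Fin n), ∃ N : ℤ, v x k - ((x : EuclideanSpace ℝ (Fin n)) k - pl k) = N := by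
        intro x k
        have h3 := (hg _ (hmem x)).2.2
        rw [hv', ftPath_apply] at h3
        obtain ⟨m, hm⟩ := (ft_mk_eq_iff _ _).1 h3 k
        refine ⟨-m, ?_⟩
        simp at hm
        push_cast
        linarith
      choose N hN using hN
      have : PreconnectedSpace K := Subtype.preconnectedSpace hKconv.isPreconnected
      have hNconst : ∀ (x y : K) (k : Fin n), N x k = N y k := by
        intro x y k
        have hNc : Continuous (fun x => N x k) := by
          rw [Int.isClosedEmbedding_coe_real.isInducing.continuous_iff]
          have : ((fun m : ℤ => (m : ℝ)) ∘ fun x => N x k) =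
              fun x : K => v x k - ((x : EuclideanSpace ℝ (Fin n)) k - pl k) := by
            funext x
            exact (hN x k).symm
          rw [this]
          fun_prop
        exact PreconnectedSpace.constant inferInstance hNc
      have hN1 : ∀ k : Fin n, (k : ℕ) < i → N ⟨ql, hqK⟩ k = -1 := by
        intro k hk
        let z : EuclideanSpace ℝ (Fin n) := ql + EuclideanSpace.single k ε
        have hzk : z k = ql k + ε := by simp [z]
        have hz : z ∈ K := by
          intro j
          by_cases hj : j = k
          · subst hj
            refine ⟨fun _ => ?_, fun h => absurd h (by omega)⟩
            rw [hzk]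
            exact ⟨by linarith, le_refl _⟩
          · have : z j = ql j := by simp [z, hj]
            rw [this]
            exact ⟨fun _ => ⟨le_refl _, by linarith⟩, fun _ => rfl⟩
        rw [hNconst _ ⟨z, hz⟩ k]
        have h1 := hN ⟨z, hz⟩ k
        have h2 := abs_le.1 (hv ⟨z, hz⟩ k)
        have h3 := hqk k
        simp only [hzk] at h1
        have h4 : ((N ⟨z, hz⟩ k : ℤ) : ℝ) < ((0 : ℤ) : ℝ) := by push_cast; linarith
        have h5 : ((-2 : ℤ) : ℝ) < ((N ⟨z, hz⟩ k : ℤ) : ℝ) := by push_cast; linarith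
        have h4 := Int.cast_lt.1 h4
        have h5 := Int.cast_lt.1 h5
        omega
      have hN2 : ∀ k : Fin n, N ⟨ql, hqK⟩ k = 0 ∨ N ⟨ql, hqK⟩ k = -1 := by
        intro k
        have h1 := hN ⟨ql, hqK⟩ k
        have h2 := abs_le.1 (hv ⟨ql, hqK⟩ k)
        have h3 := hqk k
        simp only at h1
        have h4 : ((N ⟨ql, hqK⟩ k : ℤ) : ℝ) < ((1 : ℤ) : ℝ) := by push_cast; linarith
        have h5 : ((-2 : ℤ) : ℝ) < ((N ⟨ql, hqK⟩ k : ℤ) : ℝ) := by push_cast; linarith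
        have h4 := Int.cast_lt.1 h4
        have h5 := Int.cast_lt.1 h5
        omega
      refine ⟨fun k => decide (N ⟨ql, hqK⟩ k = 0), ?_⟩
      funext e
      obtain ⟨⟨a, b⟩, ha, hb⟩ := e
      obtain ⟨h1, h2⟩ := hsB b hb
      have ha' : a = QuotientAddGroup.mk pl := ha
      subst ha'
      change ftPath pl (s b - pl + ftShift _) = σ' (QuotientAddGroup.mk pl, b)
      have h3 := hv' ⟨s b, h1⟩
      simp only [h2] at h3
      rw [h3]
      congr 1
      ext k
      have h4 := hN ⟨s b, h1⟩ k
      rw [hNconst _ ⟨ql, hqK⟩ k] at h4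
      simp only at h4
      simp only [PiLp.add_apply, PiLp.sub_apply, ftShift, decide_eq_true_eq]
      split_ifs with h h'
      · rw [h'] at h4
        push_cast at h4
        linarith
      · rw [(hN2 k).resolve_left h'] at h4
        push_cast at h4
        linarith
      · rw [hN1 k (not_le.1 h)] at h4
        push_cast at h4
        linarith
    · rintro g ⟨S, rfl⟩
      exact ⟨σ S, hσ S, rfl⟩
  have hinj : Function.Injective (fun S => Set.restrict
          ({(QuotientAddGroup.mk pl : FlatTorus n)} ×ˢ B) (σ S)) := by
    intro S S' h
    have hm : ((QuotientAddGroup.mk pl, QuotientAddGroup.mk ql) :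
          FlatTorus n × FlatTorus n) ∈ ({(QuotientAddGroup.mk pl : FlatTorus n)} ×ˢ B :
          Set (FlatTorus n × FlatTorus n)) := by
      refine ⟨rfl, ?_⟩
      rw [hB]
      exact ⟨ql, hqK, rfl⟩
    have h1 := congrFun h ⟨_, hm⟩
    change ftPath pl (s (QuotientAddGroup.mk ql) - pl + ftShift S) =
      ftPath pl (s (QuotientAddGroup.mk ql) - pl + ftShift S') at h1
    rw [hs ql hqK] at h1
    exact ftShift_inj S S' (add_left_cancel
      (ftPath_inj pl _ _ (hbound S ql hqK) (hbound S' ql hqK) h1))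
  rw [hset, ← Set.image_univ, Set.ncard_image_of_injective _ hinj, Set.ncard_univ, ft_card]
end

section
/- Let Tⁿ be the flat n-torus, p ∈ Tⁿ, q = p + (1/2, …, 1/2) the antipodal point, and 0 < ε < 1/2. Fix 0 ≤ i ≤ n and let B = ∏_{k=1}^{i} [q_k, q_k + ε] × ∏_{k=i+1}^{n} {q_k} ⊆ Tⁿ, and let B° = ∏_{k=1}^{i} (q_k, q_k + ε) × ∏_{k=i+1}^{n} {q_k} be its relative interior. Then every geodesic from p to a point of B° extends to a GMPR on {p} × B; that is, for every geodesic G with π_GX(G) ∈ {p} × B° there exists a GMPR σ on {p} × B with σ(π_GX(G)) = G. -/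
theorem aux_coe_one : ((1 : unitInterval) : ℝ) = 1 := rfl

theorem aux_coe_zero : ((0 : unitInterval) : ℝ) = 0 := rfl

theorem aux_continuousOn_invFunOn {X Y : Type*} [TopologicalSpace X] [TopologicalSpace Y]
    [T2Space Y] [Nonempty X] {f : X → Y} {K : Set X} (hK : IsCompact K) (hf : Continuous f)
    (hinj : Set.InjOn f K) : ContinuousOn (Function.invFunOn f K) (f '' K) := by
  rw [continuousOn_iff_isClosed]
  intro t ht
  refine ⟨f '' (t ∩ K), ((hK.inter_left ht).image hf).isClosed, ?_⟩
  ext y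
  constructor
  · rintro ⟨hy, x, hx, rfl⟩
    have h := hinj.leftInvOn_invFunOn hx
    refine ⟨⟨x, ⟨?_, hx⟩, rfl⟩, x, hx, rfl⟩
    rw [Set.mem_preimage, h] at hy
    exact hy
  · rintro ⟨⟨x, ⟨hxt, hx⟩, rfl⟩, -⟩
    refine ⟨?_, x, hx, rfl⟩
    rw [Set.mem_preimage, hinj.leftInvOn_invFunOn hx]
    exact hxt

theorem aux_mem_intLattice {n : ℕ} {x : EuclideanSpace ℝ (Fin n)} :
    x ∈ intLattice n ↔ ∀ i, ∃ m : ℤ, x i = m := Iff.rfl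

theorem aux_mk_eq {n : ℕ} {x y : EuclideanSpace ℝ (Fin n)} :
    (QuotientAddGroup.mk x : FlatTorus n) = QuotientAddGroup.mk y ↔
      ∀ k, ∃ m : ℤ, y k = x k + m := by
  rw [QuotientAddGroup.eq, aux_mem_intLattice]
  refine forall_congr' fun k => exists_congr fun m => ?_
  simp only [PiLp.add_apply, PiLp.neg_apply]
  constructor <;> intro h <;> linarith

/-- Reduced representative. -/
noncomputable def auxRed {n : ℕ} (x : EuclideanSpace ℝ (Fin n)) : EuclideanSpace ℝ (Fin n) :=
  WithLp.toLp 2 fun k => x k - round (x k)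

theorem auxRed_mk {n : ℕ} (x : EuclideanSpace ℝ (Fin n)) :
    (QuotientAddGroup.mk (auxRed x) : FlatTorus n) = QuotientAddGroup.mk x := by
  rw [aux_mk_eq]
  intro k
  exact ⟨round (x k), by simp [auxRed]⟩

theorem auxRed_norm {n : ℕ} (x : EuclideanSpace ℝ (Fin n)) :
    ‖(QuotientAddGroup.mk x : FlatTorus n)‖ = ‖auxRed x‖ := by
  apply le_antisymm
  · rw [← auxRed_mk]
    exact QuotientAddGroup.norm_mk_le_norm
  · rw [QuotientAddGroup.norm_mk]
    rw [Metric.le_infDist ⟨0, (intLattice n).zero_mem⟩]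
    intro y hy
    rw [dist_eq_norm, ← sq_le_sq₀ (norm_nonneg _) (norm_nonneg _),
      EuclideanSpace.real_norm_sq_eq, EuclideanSpace.real_norm_sq_eq]
    refine Finset.sum_le_sum fun k _ => ?_
    obtain ⟨m, hm⟩ := hy k
    rw [sq_le_sq]
    simpa [auxRed, hm] using round_le (x k) m

theorem aux_norm_of_small {n : ℕ} (x : EuclideanSpace ℝ (Fin n)) (hx : ∀ k, |x k| ≤ 1 / 2) :
    ‖(QuotientAddGroup.mk x : FlatTorus n)‖ = ‖x‖ := by
  apply le_antisymm QuotientAddGroup.norm_mk_le_norm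
  rw [auxRed_norm, ← sq_le_sq₀ (norm_nonneg _) (norm_nonneg _),
      EuclideanSpace.real_norm_sq_eq, EuclideanSpace.real_norm_sq_eq]
  refine Finset.sum_le_sum fun k _ => ?_
  rw [sq_le_sq]
  have h1 := hx k
  show |x k| ≤ |x k - round (x k)|
  by_cases h0 : round (x k) = 0
  · simp [h0]
  · have h2 : (1 : ℝ) ≤ |((round (x k) : ℤ) : ℝ)| := by
      exact_mod_cast Int.one_le_abs h0
    have h3 := abs_sub_abs_le_abs_sub ((round (x k) : ℤ) : ℝ) (x k)
    rw [abs_sub_comm] at h3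
    linarith

theorem aux_small_of_norm {n : ℕ} (x : EuclideanSpace ℝ (Fin n))
    (hx : ‖(QuotientAddGroup.mk x : FlatTorus n)‖ = ‖x‖) (k : Fin n) : |x k| ≤ 1 / 2 := by
  have h : ‖auxRed x‖ ^ 2 = ‖x‖ ^ 2 := by rw [← auxRed_norm, hx]
  rw [EuclideanSpace.real_norm_sq_eq, EuclideanSpace.real_norm_sq_eq] at h
  have h2 := (Finset.sum_eq_sum_iff_of_le (s := Finset.univ) (fun k _ => by
    rw [sq_le_sq]
    simpa [auxRed] using round_le (x k) 0)).1 h k (Finset.mem_univ k)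
  rw [sq_eq_sq_iff_abs_eq_abs] at h2
  rw [← h2]
  exact abs_sub_round (x k)

theorem aux_exists_lift {n : ℕ} (g : FlatTorus n) :
    ∃ v : EuclideanSpace ℝ (Fin n), (QuotientAddGroup.mk v : FlatTorus n) = g ∧ ‖v‖ = ‖g‖ := by
  obtain ⟨x, rfl⟩ := QuotientAddGroup.mk_surjective g
  exact ⟨auxRed x, auxRed_mk x, (auxRed_norm x).symm⟩

theorem aux_ray {n : ℕ} (a b : EuclideanSpace ℝ (Fin n))
    (h : ‖(QuotientAddGroup.mk (a + b) : FlatTorus n)‖ = ‖a‖ + ‖b‖) : ‖b‖ • a = ‖a‖ • b := by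
  rw [← norm_add_eq_iff_real]
  exact le_antisymm (norm_add_le _ _) (h ▸ QuotientAddGroup.norm_mk_le_norm)

/-- Straight path. -/
noncomputable def auxPath {n : ℕ} (pl : EuclideanSpace ℝ (Fin n)) :
    C(EuclideanSpace ℝ (Fin n), C(unitInterval, FlatTorus n)) :=
  ContinuousMap.curry ⟨fun z => QuotientAddGroup.mk (pl + (z.2 : ℝ) • z.1),
    continuous_quotient_mk'.comp (by fun_prop)⟩

theorem auxPath_apply {n : ℕ} (pl w : EuclideanSpace ℝ (Fin n)) (t : unitInterval) :
    auxPath pl w t = QuotientAddGroup.mk (pl + (t : ℝ) • w) := rfl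

theorem auxPath_geodesic {n : ℕ} (pl w : EuclideanSpace ℝ (Fin n)) (hw : ∀ k, |w k| ≤ 1 / 2) :
    IsGeodesic (auxPath pl w) := by
  refine ⟨‖w‖, fun s t => ?_⟩
  rw [auxPath_apply, auxPath_apply, dist_eq_norm, ← QuotientAddGroup.mk_sub,
    add_sub_add_left_eq_sub, ← sub_smul, aux_norm_of_small, norm_smul, Real.norm_eq_abs, mul_comm]
  intro k
  have h1 : |(s : ℝ) - t| ≤ 1 := by
    rw [abs_le]; constructor <;> linarith [s.2.1, s.2.2, t.2.1, t.2.2]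
  rw [PiLp.smul_apply, smul_eq_mul, abs_mul]
  calc _ ≤ 1 * (1 / 2 : ℝ) := mul_le_mul h1 (hw k) (abs_nonneg _) zero_le_one
    _ = _ := by norm_num

theorem aux_geodesic_straight {n : ℕ} (pl : EuclideanSpace ℝ (Fin n))
    (G : C(unitInterval, FlatTorus n)) (hG : IsGeodesic G)
    (hG0 : G 0 = (QuotientAddGroup.mk pl : FlatTorus n)) :
    ∃ v : EuclideanSpace ℝ (Fin n), (∀ k, |v k| ≤ 1 / 2) ∧ G = auxPath pl v := by
  obtain ⟨c, hc⟩ := hG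
  have hc0 : 0 ≤ c := by
    have := hc 1 0
    simp at this
    rw [← this]; exact dist_nonneg
  set h : unitInterval := ⟨1 / 2, by norm_num, by norm_num⟩ with hh
  have hhv : (h : ℝ) = 1 / 2 := rfl
  obtain ⟨a, ha, hna⟩ := aux_exists_lift (G h - G 0)
  have hna' : ‖a‖ = c / 2 := by
    rw [hna, ← dist_eq_norm, hc, hhv]
    norm_num
    ring
  have hGh : G h = QuotientAddGroup.mk (pl + a) := by
    rw [QuotientAddGroup.mk_add, ha, hG0]; abel
  -- the common cancellation step
  have key : ∀ (b : EuclideanSpace ℝ (Fin n)) (r : ℝ), 0 ≤ r → ‖b‖ = r * c →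
      ‖b‖ • a = ‖a‖ • b → b = (2 * r) • a := by
    intro b r hr hb hab
    rcases hc0.eq_or_lt with h0 | h0
    · rw [← h0] at hb hna'
      have : b = 0 := by simpa using hb
      have : a = 0 := by simpa using hna'
      simp [*]
    · rw [hb, hna'] at hab
      have h2 : b = (2 / c) • ((c / 2) • b) := by
        rw [smul_smul]
        have : 2 / c * (c / 2) = 1 := by field_simp
        rw [this, one_smul]
      rw [h2, ← hab, smul_smul]
      congr 1
      field_simp
  have up : ∀ t : unitInterval, (1 / 2 : ℝ) ≤ t → ∃ b : EuclideanSpace ℝ (Fin n),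
      (QuotientAddGroup.mk b : FlatTorus n) = G t - G h ∧ b = (2 * ((t : ℝ) - 1 / 2)) • a := by
    intro t ht
    obtain ⟨b, hb, hnb⟩ := aux_exists_lift (G t - G h)
    have hnb' : ‖b‖ = ((t : ℝ) - 1 / 2) * c := by
      rw [hnb, ← dist_eq_norm, hc, hhv, abs_of_nonneg (by linarith), mul_comm]
    refine ⟨b, hb, key b _ (by linarith) hnb' (aux_ray a b ?_)⟩
    rw [QuotientAddGroup.mk_add, ha, hb, hna', hnb']
    have : G h - G 0 + (G t - G h) = G t - G 0 := by abel
    rw [this, ← dist_eq_norm, hc]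
    rw [aux_coe_zero, sub_zero, abs_of_nonneg t.2.1]
    ring
  have hpath : G = auxPath pl ((2 : ℝ) • a) := by
    ext t
    rw [auxPath_apply]
    rcases le_total (1 / 2 : ℝ) t with ht | ht
    · obtain ⟨b, hb, hb'⟩ := up t ht
      have e : G t = G h + QuotientAddGroup.mk b := by rw [hb]; abel
      rw [e, hGh, ← QuotientAddGroup.mk_add, hb']
      congr 1
      module
    · obtain ⟨e, he, he'⟩ := up 1 (by norm_num)
      have he'' : e = a := by
        rw [he', aux_coe_one]
        norm_num
      rw [he''] at he
      obtain ⟨b, hb, hnb⟩ := aux_exists_lift (G h - G t)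
      have hnb' : ‖b‖ = (1 / 2 - (t : ℝ)) * c := by
        rw [hnb, ← dist_eq_norm, hc, hhv, abs_of_nonneg (by linarith), mul_comm]
      have hb' := key b _ (by linarith) hnb' ((aux_ray a b (by
        rw [QuotientAddGroup.mk_add, he, hb, hna', hnb']
        have : G 1 - G h + (G h - G t) = G 1 - G t := by abel
        rw [this, ← dist_eq_norm, hc, aux_coe_one, abs_of_nonneg (by linarith [t.2.2])]
        ring)))
      have e : G t = G h - QuotientAddGroup.mk b := by rw [hb]; abel
      rw [e, hGh, ← QuotientAddGroup.mk_sub, hb']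
      congr 1
      module
  refine ⟨(2 : ℝ) • a, aux_small_of_norm _ ?_, hpath⟩
  have e : (QuotientAddGroup.mk ((2 : ℝ) • a) : FlatTorus n) = G 1 - G 0 := by
    rw [hG0, hpath, auxPath_apply, aux_coe_one, one_smul, QuotientAddGroup.mk_add]
    abel
  rw [e, ← dist_eq_norm, hc, norm_smul, hna']
  norm_num
  ring

/-- **Geodesics into the relative interior of a box extend to GMPRs.**
Let `p ∈ Tⁿ` (with lift `pl`), `q = p + (1/2, …, 1/2)` (with lift
`ql = pl + (1/2, …, 1/2)`), `0 < ε < 1/2` and `0 ≤ i ≤ n`.  Let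
`B = ∏_{k<i} [q_k, q_k + ε] × ∏_{k≥i} {q_k}` be the `i`-dimensional
axis-oriented `ε`-box with vertex `q`, and let `B°` be its relative interior
`∏_{k<i} (q_k, q_k + ε) × ∏_{k≥i} {q_k}`.  Then every geodesic `G` from `p`
to a point of `B°` extends to a GMPR on `{p} × B`. -/
theorem flatTorus_geodesic_extends_to_gmpr_on_box (n i : ℕ) (hi : i ≤ n)
    (pl : EuclideanSpace ℝ (Fin n)) (ε : ℝ) (hε : 0 < ε) (hε' : ε < 1 / 2)
    (ql : EuclideanSpace ℝ (Fin n)) (hql : ql = pl + halfVec n)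
    (B Bint : Set (FlatTorus n))
    (hB : B = QuotientAddGroup.mk ''
      {x : EuclideanSpace ℝ (Fin n) | ∀ k : Fin n,
        ((k : ℕ) < i → x k ∈ Set.Icc (ql k) (ql k + ε)) ∧
        (i ≤ (k : ℕ) → x k = ql k)})
    (hBint : Bint = QuotientAddGroup.mk ''
      {x : EuclideanSpace ℝ (Fin n) | ∀ k : Fin n,
        ((k : ℕ) < i → x k ∈ Set.Ioo (ql k) (ql k + ε)) ∧
        (i ≤ (k : ℕ) → x k = ql k)})
    (G : C(unitInterval, FlatTorus n)) (hG : IsGeodesic G)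
    (hG0 : G 0 = (QuotientAddGroup.mk pl : FlatTorus n)) (hG1 : G 1 ∈ Bint) :
    ∃ σ' : FlatTorus n × FlatTorus n → C(unitInterval, FlatTorus n),
      IsGMPROn ({(QuotientAddGroup.mk pl : FlatTorus n)} ×ˢ B) σ' ∧
      σ' (G 0, G 1) = G := by
  classical
  obtain ⟨v, hv, rfl⟩ := aux_geodesic_straight pl G hG hG0
  set K := {x : EuclideanSpace ℝ (Fin n) | ∀ k : Fin n,
        ((k : ℕ) < i → x k ∈ Set.Icc (ql k) (ql k + ε)) ∧
        (i ≤ (k : ℕ) → x k = ql k)} with hKdef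
  have hq : ∀ k, ql k = pl k + 1 / 2 := by
    intro k
    rw [hql]; simp [halfVec]
  have hKI : ∀ x ∈ K, ∀ k, x k ∈ Set.Icc (ql k) (ql k + ε) := by
    intro x hx k
    rcases lt_or_ge (k : ℕ) i with h | h
    · exact (hx k).1 h
    · rw [(hx k).2 h]; constructor <;> linarith
  have hcoord : ∀ k, Continuous fun x : EuclideanSpace ℝ (Fin n) => x k :=
    fun k => (EuclideanSpace.proj (𝕜 := ℝ) k).continuous
  have hKcl : IsClosed K := by
    simp only [hKdef, Set.ofPred_forall, Set.ofPred_and]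
    refine isClosed_iInter fun k => IsClosed.inter ?_ ?_
    · exact isClosed_iInter fun _ => isClosed_Icc.preimage (hcoord k)
    · exact isClosed_iInter fun _ => isClosed_eq (hcoord k) continuous_const
  have hK : IsCompact K := by
    have h1 : IsCompact (Set.univ.pi fun k => Set.Icc (ql k) (ql k + ε)) :=
      isCompact_univ_pi fun k => isCompact_Icc
    refine (h1.image (PiLp.continuous_toLp 2 (fun _ : Fin n => ℝ))).of_isClosed_subset hKcl ?_
    intro x hx
    exact ⟨fun k => x k, fun k _ => hKI x hx k, rfl⟩
  have hinj : Set.InjOn (QuotientAddGroup.mk : _ → FlatTorus n) K := by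
    intro x hx y hy hxy
    rw [aux_mk_eq] at hxy
    ext k
    obtain ⟨m, hm⟩ := hxy k
    have h1 := hKI x hx k
    have h2 := hKI y hy k
    have h3 : (m : ℝ) < 1 := by linarith [h1.1, h2.2]
    have h4 : (-1 : ℝ) < m := by linarith [h1.2, h2.1]
    have h5 : m < 1 := by exact_mod_cast h3
    have h6 : -1 < m := by exact_mod_cast h4
    have h7 : m = 0 := by omega
    rw [hm, h7]; simp
  have hmk : Continuous (QuotientAddGroup.mk : _ → FlatTorus n) := continuous_quotient_mk'
  have hL := aux_continuousOn_invFunOn hK hmk hinj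
  have hLinv := hinj.leftInvOn_invFunOn
  set L := Function.invFunOn (QuotientAddGroup.mk : _ → FlatTorus n) K
  let W : EuclideanSpace ℝ (Fin n) → EuclideanSpace ℝ (Fin n) := fun x =>
    WithLp.toLp 2 fun k => if (k : ℕ) < i then x k - pl k - 1 else v k
  have hWk : ∀ x k, W x k = if (k : ℕ) < i then x k - pl k - 1 else v k := fun _ _ => rfl
  have hW : Continuous W := by
    refine (PiLp.continuous_toLp 2 (fun _ : Fin n => ℝ)).comp (continuous_pi fun k => ?_)
    split_ifs
    · exact ((hcoord k).sub continuous_const).sub continuous_const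
    · exact continuous_const
  -- the endpoint of `G`
  rw [hBint] at hG1
  obtain ⟨y, hy, hy1⟩ := hG1
  rw [auxPath_apply, aux_coe_one, one_smul] at hy1
  have hyv := aux_mk_eq.1 hy1
  have hyK : y ∈ K := fun k => ⟨fun h => Set.Ioo_subset_Icc_self ((hy k).1 h), (hy k).2⟩
  have hWy : W y = v := by
    ext k
    rw [hWk]
    split_ifs with h
    · obtain ⟨m, hm⟩ := hyv k
      rw [PiLp.add_apply] at hm
      have h1 := (hy k).1 h
      rw [hq k] at h1
      have h2 := abs_le.1 (hv k)
      have h3 : (m : ℝ) < 0 := by linarith [h1.1, h2.2]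
      have h4 : (-2 : ℝ) < m := by linarith [h1.2, h2.1]
      have h5 : m < 0 := by exact_mod_cast h3
      have h6 : -2 < m := by exact_mod_cast h4
      have h7 : m = -1 := by omega
      rw [h7] at hm
      push_cast at hm
      linarith
    · rfl
  have hWsmall : ∀ x ∈ K, ∀ k, |W x k| ≤ 1 / 2 := by
    intro x hx k
    rw [hWk]
    split_ifs with h
    · have h1 := hKI x hx k
      rw [hq k] at h1
      rw [abs_le]
      constructor <;> linarith [h1.1, h1.2]
    · exact hv k
  have hWend : ∀ x ∈ K, (QuotientAddGroup.mk (pl + W x) : FlatTorus n) =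
      QuotientAddGroup.mk x := by
    intro x hx
    rw [aux_mk_eq]
    intro k
    rw [PiLp.add_apply, hWk]
    split_ifs with h
    · exact ⟨1, by push_cast; ring⟩
    · obtain ⟨m, hm⟩ := hyv k
      rw [PiLp.add_apply, (hy k).2 (not_lt.1 h)] at hm
      refine ⟨-m, ?_⟩
      rw [(hx k).2 (not_lt.1 h)]
      push_cast
      linarith
  refine ⟨fun e => auxPath pl (W (L e.2)), ⟨?_, ?_⟩, ?_⟩
  · refine ((auxPath pl).continuous.comp hW).comp_continuousOn
      (hL.comp continuousOn_snd ?_)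
    rintro ⟨a, b⟩ ⟨-, hb⟩
    rw [hB] at hb
    exact hb
  · rintro ⟨a, b⟩ ⟨ha, hb⟩
    rw [hB] at hb
    obtain ⟨x, hx, rfl⟩ := hb
    have ha' : a = QuotientAddGroup.mk pl := ha
    simp only [hLinv hx]
    refine ⟨auxPath_geodesic _ _ (hWsmall x hx), ?_, ?_⟩
    · rw [auxPath_apply, ha']; simp
    · rw [auxPath_apply, aux_coe_one, one_smul, hWend x hx]
  · simp only [auxPath_apply pl v 1, aux_coe_one, one_smul]
    rw [← hy1, hLinv hyK, hWy]
end
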